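/- Let σ be a distortion function. Then L_σ^1(P)^× = L*_{σ,∞}(P), and for every Z ∈ L_σ^1(P)^× one has |Z|*_{σ,∞} = sup{|E(ZY)| : Y ∈ L_σ^1(P), ‖Y‖_{σ,1} ≤ 1}. -/

import Mathlib

open MeasureTheory
open scoped ENNReal NNReal

noncomputable section

variable {Ω : Type*} [MeasurableSpace Ω]

/-- A `[0,1]`-valued random variable uniformly distributed on `[0,1]`:
`P(U ≤ u) = u` for all `u ∈ [0,1]`. -/
def IsUniformRV (P : Measure Ω) (U : Ω → ℝ) : Prop :=
  Measurable U ∧ (∀ ω, U ω ∈ Set.Icc (0 : ℝ) 1) ∧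
    ∀ u ∈ Set.Icc (0 : ℝ) 1, P {ω | U ω ≤ u} = ENNReal.ofReal u

/-- A distortion function: nondecreasing, nonnegative, left-continuous on `[0,1)`
with `∫₀¹ σ(u) du = 1`. -/
structure IsDistortion (σ : ℝ → ℝ) : Prop where
  nonneg : ∀ u ∈ Set.Ico (0 : ℝ) 1, 0 ≤ σ u
  mono : MonotoneOn σ (Set.Ico (0 : ℝ) 1)
  left_continuous : ∀ u ∈ Set.Ioo (0 : ℝ) 1,
    Filter.Tendsto σ (nhdsWithin u (Set.Iio u)) (nhds (σ u))
  integral_one : ∫ u in Set.Ioo (0 : ℝ) 1, σ u = 1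

/-- `‖Y‖_{σ,p}^p := sup over uniform U of E[σ(U)·‖Y‖^p]`. -/
def sigmaPow (P : Measure Ω) (σ : ℝ → ℝ) (p : ℝ) {X : Type*} [NormedAddCommGroup X]
    (Y : Ω → X) : ℝ≥0∞ :=
  ⨆ (U : Ω → ℝ) (_ : IsUniformRV P U),
    ∫⁻ ω, ENNReal.ofReal (σ (U ω)) * (‖Y ω‖₊ : ℝ≥0∞) ^ p ∂P

/-- The norm `‖Y‖_{σ,p}`. -/
def sigmaNorm (P : Measure Ω) (σ : ℝ → ℝ) (p : ℝ) {X : Type*} [NormedAddCommGroup X]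
    (Y : Ω → X) : ℝ≥0∞ :=
  sigmaPow P σ p Y ^ (1 / p)

/-- Membership in `L_σ^p(P,X)`: strongly measurable with finite `σ,p`-norm. -/
def MemLsigma (P : Measure Ω) (σ : ℝ → ℝ) (p : ℝ) {X : Type*} [NormedAddCommGroup X]
    (Y : Ω → X) : Prop :=
  AEStronglyMeasurable Y P ∧ sigmaPow P σ p Y < ∞

/-- The generalized inverse distribution function (quantile function)
`F_g^{-1}(α) = inf {q : P(g ≤ q) ≥ α}`. -/
def quantileFn (P : Measure Ω) (g : Ω → ℝ) (α : ℝ) : ℝ :=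
  sInf {q : ℝ | ENNReal.ofReal α ≤ P {ω | g ω ≤ q}}

variable {𝕂 : Type*} [RCLike 𝕂]

/-- The Köthe dual of `L_σ^p(P)`:
`{Z measurable : Z·Y ∈ L¹(P) for all Y ∈ L_σ^p(P)}`. -/
def KoetheDual (P : Measure Ω) (σ : ℝ → ℝ) (p : ℝ) (Z : Ω → 𝕂) : Prop :=
  AEStronglyMeasurable Z P ∧
    ∀ Y : Ω → 𝕂, MemLsigma P σ p Y → Integrable (fun ω => Z ω * Y ω) P

/-- The average value-at-risk of level `α` of the (nonnegative) random variable `g`: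
`AV@R_α(g) = (1/(1−α)) ∫_α^1 F_g^{-1}(u) du`. -/
def avar (P : Measure Ω) (g : Ω → ℝ) (α : ℝ) : ℝ≥0∞ :=
  ENNReal.ofReal (1 / (1 - α)) *
    ∫⁻ u in Set.Ioo α 1, ENNReal.ofReal (quantileFn P g u)

/-- `Z'` σ-dominates `Z`: there is a uniform `U` with
`AV@R_α(σ(U)·|Z'|) ≥ AV@R_α(|Z|)` for all `α < 1`. -/
def SigmaDominates (P : Measure Ω) (σ : ℝ → ℝ) (Z' Z : Ω → 𝕂) : Prop :=
  ∃ U : Ω → ℝ, IsUniformRV P U ∧ ∀ α ∈ Set.Ico (0 : ℝ) 1,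
    avar P (fun ω => ‖Z ω‖) α ≤ avar P (fun ω => σ (U ω) * ‖Z' ω‖) α

/-- `|Z|*_{σ,∞} = sup_{α ∈ [0,1)} AV@R_α(|Z|) / ((1/(1−α))·S_σ(α))
 = sup_{α ∈ [0,1)} (∫_α^1 F_{|Z|}^{-1}(u) du) / (∫_α^1 σ(u) du)`. -/
def dualNormInf (P : Measure Ω) (σ : ℝ → ℝ) (Z : Ω → 𝕂) : ℝ≥0∞ :=
  ⨆ (α : ℝ) (_ : α ∈ Set.Ico (0 : ℝ) 1),
    (∫⁻ u in Set.Ioo α 1, ENNReal.ofReal (quantileFn P (fun ω => ‖Z ω‖) u)) /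
      ENNReal.ofReal (∫ u in Set.Ioo α 1, σ u)

/-- `|Z|*_{σ,q} = inf {‖Z'‖_{σ,q} : Z' σ-dominates Z}` (with `inf ∅ = ∞`). -/
def dualNormQ (P : Measure Ω) (σ : ℝ → ℝ) (q : ℝ) (Z : Ω → 𝕂) : ℝ≥0∞ :=
  ⨅ (Z' : Ω → 𝕂) (_ : AEStronglyMeasurable Z' P ∧ SigmaDominates P σ Z' Z),
    sigmaNorm P σ q Z'

open Set Filter Topology in
lemma isLeast_quantileFn (P : Measure Ω) [IsProbabilityMeasure P] {g : Ω → ℝ}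
    (hg : Measurable g) {u : ℝ} (hu : u ∈ Ioo (0 : ℝ) 1) :
    IsLeast {q : ℝ | ENNReal.ofReal u ≤ P {ω | g ω ≤ q}} (quantileFn P g u) := by
  have := Measure.isProbabilityMeasure_map (μ := P) hg.aemeasurable
  set F := ProbabilityTheory.cdf (P.map g) with hF
  have hset : {q : ℝ | ENNReal.ofReal u ≤ P {ω | g ω ≤ q}} = {q | u ≤ F q} := by
    ext q
    have h : P {ω | g ω ≤ q} = ENNReal.ofReal (F q) := by
      rw [hF, ProbabilityTheory.ofReal_cdf, Measure.map_apply hg measurableSet_Iic]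
      rfl
    simp only [mem_ofPred_eq, h]
    exact ENNReal.ofReal_le_ofReal_iff (ProbabilityTheory.cdf_nonneg _ _)
  unfold quantileFn
  rw [hset]
  obtain ⟨b, hb⟩ : ∃ b, F b < u :=
    ((ProbabilityTheory.tendsto_cdf_atBot (P.map g)).eventually_lt_const hu.1).exists
  obtain ⟨c, hc⟩ : ∃ c, u < F c :=
    ((ProbabilityTheory.tendsto_cdf_atTop (P.map g)).eventually_const_lt hu.2).exists
  have hbdd : BddBelow {q | u ≤ F q} := by
    refine ⟨b, fun q hq => ?_⟩
    by_contra! h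
    exact absurd (hq.trans (F.mono h.le)) (not_le.2 hb)
  have hne : {q | u ≤ F q}.Nonempty := ⟨c, hc.le⟩
  refine ⟨?_, fun q hq => csInf_le hbdd hq⟩
  set y := sInf {q | u ≤ F q}
  have hcont : Tendsto F (𝓝[>] y) (𝓝 (F y)) :=
    (F.right_continuous y).mono_left (nhdsWithin_mono _ Ioi_subset_Ici_self)
  refine ge_of_tendsto hcont ?_
  filter_upwards [self_mem_nhdsWithin] with x hx
  obtain ⟨q, hq, hqx⟩ := exists_lt_of_csInf_lt hne hx
  exact le_trans hq (F.mono hqx.le)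

open Set in
lemma quantileFn_le_iff (P : Measure Ω) [IsProbabilityMeasure P] {g : Ω → ℝ}
    (hg : Measurable g) {u : ℝ} (hu : u ∈ Ioo (0 : ℝ) 1) (t : ℝ) :
    quantileFn P g u ≤ t ↔ u ≤ P.real {ω | g ω ≤ t} := by
  have h := isLeast_quantileFn P hg hu
  rw [measureReal_def, ← ENNReal.ofReal_le_iff_le_toReal (measure_ne_top _ _)]
  refine ⟨fun ht => le_trans h.1 (measure_mono fun ω hω => le_trans hω ht), fun ht => h.2 ht⟩

open Set in
lemma real_lt_le_quantile (P : Measure Ω) [IsProbabilityMeasure P] {g : Ω → ℝ}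
    (hg : Measurable g) {u : ℝ} (hu : u ∈ Ioo (0 : ℝ) 1) :
    P.real {ω | g ω < quantileFn P g u} ≤ u := by
  obtain ⟨v, hv, -, hlim⟩ := exists_seq_strictMono_tendsto (quantileFn P g u)
  have hU : {ω | g ω < quantileFn P g u} = ⋃ n, {ω | g ω ≤ v n} := by
    ext ω
    simp only [mem_ofPred_eq, mem_iUnion]
    exact ⟨fun h => ((hlim.eventually_const_lt h).exists).imp fun n hn => hn.le,
      fun ⟨n, hn⟩ => hn.trans_lt (by
        exact lt_of_lt_of_le (hv n.lt_succ_self) (hv.monotone.ge_of_tendsto hlim _))⟩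
  have hmono : Monotone fun n => {ω | g ω ≤ v n} := fun m n hmn ω hω =>
    le_trans hω (hv.monotone hmn)
  refine ENNReal.toReal_le_of_le_ofReal hu.1.le ?_
  rw [hU, hmono.measure_iUnion]
  refine iSup_le fun n => ?_
  have hn : v n < quantileFn P g u :=
    lt_of_lt_of_le (hv n.lt_succ_self) (hv.monotone.ge_of_tendsto hlim _)
  rw [← not_le, quantileFn_le_iff P hg hu, not_le] at hn
  exact (ENNReal.le_ofReal_iff_toReal_le (measure_ne_top _ _) hu.1.le).2 hn.le

open Set in
lemma quantileFn_nonneg (P : Measure Ω) [IsProbabilityMeasure P] {g : Ω → ℝ}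
    (hg : Measurable g) (hg0 : ∀ ω, 0 ≤ g ω) {u : ℝ} (hu : u ∈ Ioo (0 : ℝ) 1) :
    0 ≤ quantileFn P g u := by
  by_contra! h
  have h1 := (quantileFn_le_iff P hg hu _).1 le_rfl
  have : {ω | g ω ≤ quantileFn P g u} = ∅ := by
    ext ω
    simpa using h.trans_le (hg0 ω)
  rw [this] at h1
  simp at h1
  exact absurd hu.1 (not_lt.2 h1)

lemma measure_lt_eq_ofReal (P : Measure Ω) [IsProbabilityMeasure P] {g : Ω → ℝ}
    (hg : Measurable g) (t : ℝ) :
    P {ω | t < g ω} = ENNReal.ofReal (1 - P.real {ω | g ω ≤ t}) := by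
  have : {ω | t < g ω} = {ω | g ω ≤ t}ᶜ := by ext; simp
  rw [this, ← ofReal_measureReal, probReal_compl_eq_one_sub (measurableSet_le hg measurable_const)]

open Set in
/-- The tail integral of the quantile function, written through the survival function. -/
lemma lintegral_quantileFn_eq (P : Measure Ω) [IsProbabilityMeasure P] {g : Ω → ℝ}
    (hg : Measurable g) (hg0 : ∀ ω, 0 ≤ g ω) {α : ℝ} (hα : 0 ≤ α) :
    ∫⁻ u in Ioo α 1, ENNReal.ofReal (quantileFn P g u)
      = ∫⁻ t in Ioi (0 : ℝ), min (P {ω | t < g ω}) (ENNReal.ofReal (1 - α)) := by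
  have hsub : Ioo α 1 ⊆ Ioo (0 : ℝ) 1 := Ioo_subset_Ioo_left hα
  have hmono : MonotoneOn (quantileFn P g) (Ioo α 1) := by
    intro u hu v hv huv
    rw [quantileFn_le_iff P hg (hsub hu)]
    exact huv.trans ((quantileFn_le_iff P hg (hsub hv) _).1 le_rfl)
  rw [lintegral_eq_lintegral_meas_lt]
  · refine lintegral_congr fun t => ?_
    have hset : {u | t < quantileFn P g u} ∩ Ioo α 1
        = Ioo (max α (P.real {ω | g ω ≤ t})) 1 := by
      ext u
      simp only [mem_inter_iff, mem_ofPred_eq, mem_Ioo, max_lt_iff]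
      constructor
      · rintro ⟨h1, h2⟩
        rw [← not_le, quantileFn_le_iff P hg (hsub h2), not_le] at h1
        exact ⟨⟨h2.1, h1⟩, h2.2⟩
      · rintro ⟨⟨h1, h2⟩, h3⟩
        refine ⟨?_, h1, h3⟩
        rw [← not_le, quantileFn_le_iff P hg (hsub ⟨h1, h3⟩), not_le]
        exact h2
    rw [Measure.restrict_apply' measurableSet_Ioo, hset, Real.volume_Ioo,
      measure_lt_eq_ofReal P hg, ← ENNReal.ofReal_min, min_sub_sub_left, max_comm]
  · exact (ae_restrict_iff' measurableSet_Ioo).2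
      (.of_forall fun u hu => quantileFn_nonneg P hg hg0 (hsub hu))
  · exact aemeasurable_restrict_of_monotoneOn measurableSet_Ioo hmono

open Set in
lemma IsUniformRV.map_eq {P : Measure Ω} [IsProbabilityMeasure P] {U : Ω → ℝ}
    (hU : IsUniformRV P U) : P.map U = volume.restrict (Ioo (0 : ℝ) 1) := by
  have := Measure.isProbabilityMeasure_map (μ := P) hU.1.aemeasurable
  refine Measure.ext_of_Iic _ _ fun a => ?_
  rw [Measure.map_apply hU.1 measurableSet_Iic, Measure.restrict_apply measurableSet_Iic]
  change P {ω | U ω ≤ a} = _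
  rcases lt_or_ge a 0 with ha | ha
  · have h1 : {ω | U ω ≤ a} = ∅ := by
      ext ω
      simpa using ha.trans_le (hU.2.1 ω).1
    have h2 : Iic a ∩ Ioo (0 : ℝ) 1 = ∅ := by
      ext x
      simp only [mem_inter_iff, mem_Iic, mem_Ioo, mem_empty_iff_false, iff_false]
      rintro ⟨h, h', -⟩
      linarith
    simp [h1, h2]
  rcases lt_or_ge a 1 with ha1 | ha1
  · have h2 : Iic a ∩ Ioo (0 : ℝ) 1 = Ioc 0 a := by
      ext x
      simp only [mem_inter_iff, mem_Iic, mem_Ioo, mem_Ioc]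
      exact ⟨fun h => ⟨h.2.1, h.1⟩, fun h => ⟨h.2, h.1, h.2.trans_lt ha1⟩⟩
    rw [hU.2.2 a ⟨ha, ha1.le⟩, h2, Real.volume_Ioc, sub_zero]
  · have h1 : {ω | U ω ≤ a} = univ := by
      ext ω
      simpa using (hU.2.1 ω).2.trans ha1
    have h2 : Iic a ∩ Ioo (0 : ℝ) 1 = Ioo 0 1 := by
      ext x
      simp only [mem_inter_iff, mem_Iic, mem_Ioo, and_iff_right_iff_imp]
      exact fun h => (h.2.trans_le ha1).le
    rw [h1, h2, measure_univ, Real.volume_Ioo]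
    simp

open Set in
lemma IsUniformRV.measure_preimage_Ioi {P : Measure Ω} [IsProbabilityMeasure P] {U : Ω → ℝ}
    (hU : IsUniformRV P U) {α : ℝ} (hα : α ∈ Icc (0 : ℝ) 1) :
    P {ω | α < U ω} = ENNReal.ofReal (1 - α) := by
  rw [measure_lt_eq_ofReal P hU.1, measureReal_def, hU.2.2 α hα, ENNReal.toReal_ofReal hα.1]

open Set in
/-- Every real random variable on a rich space admits a comonotone uniform random variable. -/
lemma exists_uniform_comonotone (P : Measure Ω) [IsProbabilityMeasure P]
    (hrich : ∃ U : Ω → ℝ, IsUniformRV P U) {g : Ω → ℝ} (hg : Measurable g) :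
    ∃ U : Ω → ℝ, IsUniformRV P U ∧
      ∀ t : ℝ, {ω | t < g ω} =ᵐ[P] {ω | P.real {ω | g ω ≤ t} < U ω} := by
  obtain ⟨V, hV⟩ := hrich
  have hVm := hV.1
  let D : ℝ → ℝ → Set Ω := fun y v => {ω | g ω < y ∨ (g ω = y ∧ V ω ≤ v)}
  have hDm : ∀ y v, MeasurableSet (D y v) := fun y v =>
    (measurableSet_lt hg measurable_const).union
      ((measurableSet_eq_fun hg measurable_const).inter (measurableSet_le hVm measurable_const))
  let U : Ω → ℝ := fun ω => P.real (D (g ω) (V ω))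
  have hUm : Measurable U := by
    have hs : MeasurableSet {p : Ω × Ω | g p.2 < g p.1 ∨ (g p.2 = g p.1 ∧ V p.2 ≤ V p.1)} :=
      (measurableSet_lt (hg.comp measurable_snd) (hg.comp measurable_fst)).union
        ((measurableSet_eq_fun (hg.comp measurable_snd) (hg.comp measurable_fst)).inter
          (measurableSet_le (hVm.comp measurable_snd) (hVm.comp measurable_fst)))
    exact (measurable_measure_prodMk_left (ν := P) hs).ennreal_toReal
  have hD : ∀ u ∈ Ioo (0 : ℝ) 1, ∃ y v, P.real (D y v) = u := by
    intro u hu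
    set y := quantileFn P g u
    have hlo : P.real {ω | g ω < y} ≤ u := real_lt_le_quantile P hg hu
    have hhi : u ≤ P.real {ω | g ω ≤ y} := (quantileFn_le_iff P hg hu _).1 le_rfl
    have hDmono : ∀ v w, v ≤ w → D y v ⊆ D y w := fun v w hvw ω hω =>
      hω.imp id fun h => ⟨h.1, h.2.trans hvw⟩
    have hstep : ∀ v ∈ Icc (0 : ℝ) 1, ∀ w ∈ Icc (0 : ℝ) 1, v ≤ w →
        P.real (D y w) ≤ P.real (D y v) + (w - v) := by
      intro v hv w hw hvw
      have h1 : D y w ⊆ D y v ∪ {ω | v < V ω ∧ V ω ≤ w} := by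
        rintro ω (h | ⟨h, h'⟩)
        · exact Or.inl (Or.inl h)
        · rcases le_or_gt (V ω) v with h2 | h2
          · exact Or.inl (Or.inr ⟨h, h2⟩)
          · exact Or.inr ⟨h2, h'⟩
      have h2 : {ω | v < V ω ∧ V ω ≤ w} = {ω | V ω ≤ w} \ {ω | V ω ≤ v} := by
        ext ω
        simp [and_comm]
      have h3 : P.real {ω | v < V ω ∧ V ω ≤ w} = w - v := by
        have h4 : {ω | V ω ≤ v} ⊆ {ω | V ω ≤ w} := fun ω hω => le_trans hω hvw
        rw [h2, measureReal_sdiff h4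
          (measurableSet_le hVm measurable_const), measureReal_def, measureReal_def,
          hV.2.2 v hv, hV.2.2 w hw, ENNReal.toReal_ofReal hv.1, ENNReal.toReal_ofReal hw.1]
      calc P.real (D y w) ≤ P.real (D y v ∪ {ω | v < V ω ∧ V ω ≤ w}) := measureReal_mono h1
        _ ≤ _ := measureReal_union_le _ _
        _ = _ := by rw [h3]
    have hcont : ContinuousOn (fun v => P.real (D y v)) (Icc 0 1) := by
      refine LipschitzOnWith.continuousOn (K := 1) (LipschitzOnWith.of_le_add ?_)
      intro v hv w hw
      rw [Real.dist_eq]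
      rcases le_total v w with h | h
      · exact (measureReal_mono (hDmono v w h)).trans (le_add_of_nonneg_right (abs_nonneg _))
      · exact (hstep w hw v hv h).trans (by gcongr; exact le_abs_self _)
    have h0 : P.real (D y 0) ≤ u := by
      have h1 : D y 0 ⊆ {ω | g ω < y} ∪ {ω | V ω ≤ 0} := fun ω hω => hω.imp id fun h => h.2
      have h2 : P.real {ω | V ω ≤ 0} = 0 := by
        rw [measureReal_def, hV.2.2 0 (by simp)]
        simp
      calc P.real (D y 0) ≤ P.real ({ω | g ω < y} ∪ {ω | V ω ≤ 0}) := measureReal_mono h1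
        _ ≤ _ := measureReal_union_le _ _
        _ ≤ u := by rw [h2, add_zero]; exact hlo
    have h1 : u ≤ P.real (D y 1) := by
      refine hhi.trans (measureReal_mono fun ω hω => ?_)
      exact (lt_or_eq_of_le hω).imp id fun h => ⟨h, (hV.2.1 ω).2⟩
    obtain ⟨v, -, hv⟩ := intermediate_value_Icc zero_le_one hcont ⟨h0, h1⟩
    exact ⟨y, v, hv⟩
  have hlow : ∀ u ∈ Ioo (0 : ℝ) 1, ENNReal.ofReal u ≤ P {ω | U ω ≤ u} := by
    intro u hu
    obtain ⟨y, v, h⟩ := hD u hu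
    rw [← h, ofReal_measureReal]
    refine measure_mono fun ω hω => measureReal_mono fun ω' hω' => ?_
    rcases hω with h1 | ⟨h1, h2⟩ <;> rcases hω' with h3 | ⟨h3, h4⟩
    · exact Or.inl (h3.trans h1)
    · exact Or.inl (h3 ▸ h1)
    · exact Or.inl (h1 ▸ h3)
    · exact Or.inr ⟨h3.trans h1, h4.trans h2⟩
  have hupp : ∀ u ∈ Ioo (0 : ℝ) 1, P {ω | U ω < u} ≤ ENNReal.ofReal u := by
    intro u hu
    obtain ⟨y, v, h⟩ := hD u hu
    nth_rewrite 2 [← h]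
    rw [ofReal_measureReal]
    refine measure_mono fun ω hω => ?_
    by_contra hn
    have hn' : ¬ (g ω < y ∨ (g ω = y ∧ V ω ≤ v)) := hn
    push Not at hn'
    refine absurd (show U ω < u from hω) (not_lt.2 ?_)
    rw [← h]
    refine measureReal_mono fun ω' hω' => ?_
    rcases hn'.1.eq_or_lt with h1 | h1
    · rcases hω' with h3 | ⟨h3, h4⟩
      · exact Or.inl (h1 ▸ h3)
      · exact Or.inr ⟨h3.trans h1, h4.trans (hn'.2 h1.symm).le⟩
    · exact Or.inl (hω'.elim (fun h => h.trans h1) fun h => h.1 ▸ h1)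
  have hU01 : ∀ ω, U ω ∈ Icc (0 : ℝ) 1 := fun ω => ⟨measureReal_nonneg, measureReal_le_one⟩
  have hupp' : ∀ u ∈ Ico (0 : ℝ) 1, P {ω | U ω ≤ u} ≤ ENNReal.ofReal u := by
    intro u hu
    have hc : Filter.Tendsto ENNReal.ofReal (nhdsWithin u (Ioi u)) (nhds (ENNReal.ofReal u)) :=
      ENNReal.continuous_ofReal.continuousWithinAt
    refine ge_of_tendsto hc ?_
    filter_upwards [Ioo_mem_nhdsGT hu.2] with x hx
    refine le_trans (measure_mono fun ω hω => ?_) (hupp x ⟨hu.1.trans_lt hx.1, hx.2⟩)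
    exact lt_of_le_of_lt hω hx.1
  have hUu : IsUniformRV P U := by
    refine ⟨hUm, hU01, fun u hu => ?_⟩
    rcases hu.2.eq_or_lt with rfl | h1
    · have : {ω | U ω ≤ 1} = univ := eq_univ_of_forall fun ω => (hU01 ω).2
      simp [this]
    refine le_antisymm (hupp' u ⟨hu.1, h1⟩) ?_
    rcases hu.1.eq_or_lt with rfl | h0
    · simp
    · exact hlow u ⟨h0, h1⟩
  refine ⟨U, hUu, fun t => ?_⟩
  have h01 : P.real {ω | g ω ≤ t} ∈ Icc (0 : ℝ) 1 := ⟨measureReal_nonneg, measureReal_le_one⟩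
  refine (ae_eq_of_subset_of_measure_ge (fun ω hω => ?_) ?_
    (measurableSet_lt measurable_const hUm).nullMeasurableSet (measure_ne_top _ _)).symm
  · by_contra hn
    have hn' : g ω ≤ t := not_lt.1 hn
    refine absurd (show _ < U ω from hω) (not_lt.2 (measureReal_mono fun ω' hω' => ?_))
    exact (hω'.elim (fun h => h.le) fun h => h.1.le).trans hn'
  · rw [hUu.measure_preimage_Ioi h01, measure_lt_eq_ofReal P hg]

open Set in
lemma setLIntegral_le_tail_quantileFn (P : Measure Ω) [IsProbabilityMeasure P] {g : Ω → ℝ}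
    (hg : Measurable g) (hg0 : ∀ ω, 0 ≤ g ω) {α : ℝ} (hα : 0 ≤ α) {B : Set Ω}
    (hB : MeasurableSet B) (hPB : P B ≤ ENNReal.ofReal (1 - α)) :
    ∫⁻ ω in B, ENNReal.ofReal (g ω) ∂P
      ≤ ∫⁻ u in Ioo α 1, ENNReal.ofReal (quantileFn P g u) := by
  rw [lintegral_quantileFn_eq P hg hg0 hα,
    lintegral_eq_lintegral_meas_lt _ (.of_forall hg0) hg.aemeasurable]
  refine lintegral_mono fun t => le_min (Measure.restrict_apply_le _ _) ?_
  rw [Measure.restrict_apply' hB]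
  exact (measure_mono inter_subset_right).trans hPB

open Set in
lemma exists_setLIntegral_eq_tail_quantileFn (P : Measure Ω) [IsProbabilityMeasure P]
    (hrich : ∃ U : Ω → ℝ, IsUniformRV P U) {g : Ω → ℝ}
    (hg : Measurable g) (hg0 : ∀ ω, 0 ≤ g ω) {α : ℝ} (hα : α ∈ Ico (0 : ℝ) 1) :
    ∃ B : Set Ω, MeasurableSet B ∧ P B = ENNReal.ofReal (1 - α) ∧
      ∫⁻ ω in B, ENNReal.ofReal (g ω) ∂P
        = ∫⁻ u in Ioo α 1, ENNReal.ofReal (quantileFn P g u) := by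
  obtain ⟨U, hU, hcom⟩ := exists_uniform_comonotone P hrich hg
  have hB : MeasurableSet {ω | α < U ω} := measurableSet_lt measurable_const hU.1
  refine ⟨{ω | α < U ω}, hB, hU.measure_preimage_Ioi ⟨hα.1, hα.2.le⟩, ?_⟩
  rw [lintegral_quantileFn_eq P hg hg0 hα.1,
    lintegral_eq_lintegral_meas_lt _ (.of_forall hg0) hg.aemeasurable]
  refine lintegral_congr fun t => ?_
  have h01 : P.real {ω | g ω ≤ t} ∈ Icc (0 : ℝ) 1 := ⟨measureReal_nonneg, measureReal_le_one⟩
  have hset : {ω | P.real {ω | g ω ≤ t} < U ω} ∩ {ω | α < U ω}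
      = {ω | max (P.real {ω | g ω ≤ t}) α < U ω} := by
    ext ω
    simp
  have hae : ({ω | t < g ω} ∩ {ω | α < U ω} : Set Ω)
      =ᵐ[P] ({ω | P.real {ω | g ω ≤ t} < U ω} ∩ {ω | α < U ω} : Set Ω) :=
    (hcom t).inter (ae_eq_refl _)
  rw [Measure.restrict_apply' hB, measure_congr hae, hset,
    hU.measure_preimage_Ioi ⟨hα.1.trans (le_max_right _ _), max_le h01.2 hα.2.le⟩,
    measure_lt_eq_ofReal P hg, ← ENNReal.ofReal_min, min_sub_sub_left]

namespace IsDistortion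

open Set

variable {σ : ℝ → ℝ}

lemma integrableOn (hσ : IsDistortion σ) : IntegrableOn σ (Ioo 0 1) := by
  by_contra h
  have := hσ.integral_one
  rw [integral_undef h] at this
  exact zero_ne_one this

lemma aemeasurable_comp (hσ : IsDistortion σ) {P : Measure Ω} [IsProbabilityMeasure P]
    {U : Ω → ℝ} (hU : IsUniformRV P U) : AEMeasurable (fun ω => σ (U ω)) P := by
  refine AEMeasurable.comp_aemeasurable (g := σ) ?_ hU.1.aemeasurable
  rw [hU.map_eq]
  exact hσ.integrableOn.aemeasurable

lemma one_sub_le_integral (hσ : IsDistortion σ) {α : ℝ} (hα : α ∈ Ico (0 : ℝ) 1) :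
    1 - α ≤ ∫ u in Ioo α 1, σ u := by
  have hint := hσ.integrableOn
  have hsub : Ioo α 1 ⊆ Ioo (0 : ℝ) 1 := Ioo_subset_Ioo_left hα.1
  have hsub' : Ioc 0 α ⊆ Ioo (0 : ℝ) 1 := fun x hx => ⟨hx.1, hx.2.trans_lt hα.2⟩
  rcases le_total 1 (σ α) with h | h
  · have h1 : ∫ _ in Ioo α 1, (1 : ℝ) ≤ ∫ u in Ioo α 1, σ u := by
      refine setIntegral_mono_on (by simp) (hint.mono_set hsub) measurableSet_Ioo
        fun x hx => h.trans (hσ.mono hα ⟨(hsub hx).1.le, hx.2⟩ hx.1.le)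
    simpa [hα.2.le] using h1
  · have h1 : ∫ u in Ioc 0 α, σ u ≤ ∫ _ in Ioc 0 α, (1 : ℝ) := by
      refine setIntegral_mono_on (hint.mono_set hsub') (by simp) measurableSet_Ioc
        fun x hx => (hσ.mono ⟨hx.1.le, hx.2.trans_lt hα.2⟩ hα hx.2).trans h
    have h2 : ∫ u in Ioc 0 α ∪ Ioo α 1, σ u
        = (∫ u in Ioc 0 α, σ u) + ∫ u in Ioo α 1, σ u := by
      refine setIntegral_union ?_ measurableSet_Ioo (hint.mono_set hsub') (hint.mono_set hsub)
      exact disjoint_left.2 fun x hx hx' => absurd hx.2 (not_le.2 hx'.1)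
    rw [Ioc_union_Ioo_eq_Ioo hα.1 hα.2, hσ.integral_one] at h2
    simp only [integral_const, smul_eq_mul, mul_one, measureReal_restrict_apply, univ_inter,
      MeasurableSet.univ, Real.volume_real_Ioc_of_le hα.1] at h1
    linarith

lemma setLIntegral_comp_eq (hσ : IsDistortion σ) {P : Measure Ω} [IsProbabilityMeasure P]
    {U : Ω → ℝ} (hU : IsUniformRV P U) {α : ℝ} (hα : 0 ≤ α) :
    ∫⁻ ω in {ω | α < U ω}, ENNReal.ofReal (σ (U ω)) ∂P
      = ENNReal.ofReal (∫ u in Ioo α 1, σ u) := by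
  have hsub : Ioo α 1 ⊆ Ioo (0 : ℝ) 1 := Ioo_subset_Ioo_left hα
  have hset : Ioi α ∩ Ioo 0 1 = Ioo α 1 := by
    ext x
    simp only [mem_inter_iff, mem_Ioi, mem_Ioo]
    exact ⟨fun h => ⟨h.1, h.2.2⟩, fun h => ⟨h.1, hα.trans_lt h.1, h.2⟩⟩
  have hmap : (P.restrict {ω | α < U ω}).map U = volume.restrict (Ioo α 1) := by
    change (P.restrict (U ⁻¹' Ioi α)).map U = _
    rw [← Measure.restrict_map hU.1 measurableSet_Ioi, hU.map_eq,
      Measure.restrict_restrict measurableSet_Ioi, hset]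
  have hint := hσ.integrableOn.mono_set hsub
  rw [ofReal_integral_eq_lintegral_ofReal hint, ← hmap, lintegral_map' _ hU.1.aemeasurable]
  · rw [hmap]
    exact hint.aemeasurable.ennreal_ofReal
  · exact (ae_restrict_iff' measurableSet_Ioo).2
      (.of_forall fun u hu => hσ.nonneg u ⟨(hsub hu).1.le, hu.2⟩)

lemma setLIntegral_comp_le (hσ : IsDistortion σ) {P : Measure Ω} [IsProbabilityMeasure P]
    {U : Ω → ℝ} (hU : IsUniformRV P U) {α : ℝ} (hα : α ∈ Ico (0 : ℝ) 1) {B : Set Ω}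
    (hB : MeasurableSet B) (hPB : P B = ENNReal.ofReal (1 - α)) :
    ∫⁻ ω in B, ENNReal.ofReal (σ (U ω)) ∂P ≤ ENNReal.ofReal (∫ u in Ioo α 1, σ u) := by
  have hC : MeasurableSet {ω | α < U ω} := measurableSet_lt measurable_const hU.1
  have hPC : P {ω | α < U ω} = ENNReal.ofReal (1 - α) :=
    hU.measure_preimage_Ioi ⟨hα.1, hα.2.le⟩
  have hlt : ∀ᵐ ω ∂P, U ω < 1 := by
    have h := hU.2.2 1 (by simp)
    have h0 : P.map U (Ioo (0 : ℝ) 1)ᶜ = 0 := by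
      rw [hU.map_eq, Measure.restrict_apply measurableSet_Ioo.compl]
      simp
    rw [Measure.map_apply hU.1 measurableSet_Ioo.compl] at h0
    filter_upwards [measure_eq_zero_iff_ae_notMem.1 h0] with ω hω
    exact (not_not.1 hω).2
  rw [← hσ.setLIntegral_comp_eq hU hα.1, ← lintegral_indicator hB]
  calc ∫⁻ ω, B.indicator (fun ω => ENNReal.ofReal (σ (U ω))) ω ∂P
      ≤ ∫⁻ ω, ({ω | α < U ω}.indicator
          (fun ω => ENNReal.ofReal (σ (U ω)) - ENNReal.ofReal (σ α)) ω
          + B.indicator (fun _ => ENNReal.ofReal (σ α)) ω) ∂P := by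
        refine lintegral_mono_ae ?_
        filter_upwards [hlt] with ω hω
        by_cases hωB : ω ∈ B
        · simp only [indicator_of_mem hωB]
          by_cases hωC : ω ∈ {ω | α < U ω}
          · simp only [indicator_of_mem hωC]
            exact le_tsub_add
          · simp only [indicator_of_notMem hωC, zero_add]
            exact ENNReal.ofReal_le_ofReal
              (hσ.mono ⟨(hU.2.1 ω).1, hω⟩ hα (not_lt.1 hωC))
        · simp [indicator_of_notMem hωB]
    _ = ∫⁻ ω in {ω | α < U ω}, (ENNReal.ofReal (σ (U ω)) - ENNReal.ofReal (σ α)) ∂P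
          + ∫⁻ ω in {ω | α < U ω}, ENNReal.ofReal (σ α) ∂P := by
        rw [lintegral_add_right _ (measurable_const.indicator hB), lintegral_indicator hC,
          lintegral_indicator hB, setLIntegral_const, setLIntegral_const, hPB, hPC]
    _ = ∫⁻ ω in {ω | α < U ω}, ENNReal.ofReal (σ (U ω)) ∂P := by
        rw [← lintegral_add_right _ measurable_const]
        refine setLIntegral_congr_fun_ae hC ?_
        filter_upwards [hlt] with ω hω hωC
        exact tsub_add_cancel_of_le (ENNReal.ofReal_le_ofReal
          (hσ.mono hα ⟨(hU.2.1 ω).1, hω⟩ (le_of_lt hωC)))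

end IsDistortion

open Set in
lemma lintegral_mul_ofReal_eq_lintegral_setLIntegral (P : Measure Ω) {w : Ω → ℝ≥0∞}
    (hw : AEMeasurable w P) {y : Ω → ℝ} (hy : Measurable y) (hy0 : ∀ ω, 0 ≤ y ω) :
    ∫⁻ ω, w ω * ENNReal.ofReal (y ω) ∂P
      = ∫⁻ t in Ioi (0 : ℝ), ∫⁻ ω in {ω | t < y ω}, w ω ∂P := by
  have h := lintegral_withDensity_eq_lintegral_mul₀ hw hy.ennreal_ofReal.aemeasurable
  simp only [Pi.mul_apply] at h
  rw [← h, lintegral_eq_lintegral_meas_lt _ (.of_forall hy0) hy.aemeasurable]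
  exact lintegral_congr fun t => withDensity_apply _ (measurableSet_lt measurable_const hy)

open Set in
lemma exists_uniform_lintegral_mul_le (P : Measure Ω) [IsProbabilityMeasure P]
    (hrich : ∃ U : Ω → ℝ, IsUniformRV P U) {σ : ℝ → ℝ} (hσ : IsDistortion σ)
    {f y : Ω → ℝ} (hf : Measurable f) (hf0 : ∀ ω, 0 ≤ f ω) (hy : Measurable y)
    (hy0 : ∀ ω, 0 ≤ y ω) {C : ℝ≥0∞} (hC : C ≠ ∞)
    (hfC : ∀ α ∈ Ico (0 : ℝ) 1, ∫⁻ u in Ioo α 1, ENNReal.ofReal (quantileFn P f u)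
      ≤ C * ENNReal.ofReal (∫ u in Ioo α 1, σ u)) :
    ∃ U : Ω → ℝ, IsUniformRV P U ∧
      ∫⁻ ω, ENNReal.ofReal (f ω) * ENNReal.ofReal (y ω) ∂P
        ≤ C * ∫⁻ ω, ENNReal.ofReal (σ (U ω)) * ENNReal.ofReal (y ω) ∂P := by
  obtain ⟨U, hU, hcom⟩ := exists_uniform_comonotone P hrich hy
  refine ⟨U, hU, ?_⟩
  rw [lintegral_mul_ofReal_eq_lintegral_setLIntegral P hf.ennreal_ofReal.aemeasurable hy hy0,
    lintegral_mul_ofReal_eq_lintegral_setLIntegral P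
      (hσ.aemeasurable_comp hU).ennreal_ofReal hy hy0, ← lintegral_const_mul' _ _ hC]
  refine lintegral_mono fun t => ?_
  have hPB := measure_lt_eq_ofReal P hy t
  rcases (measureReal_le_one (μ := P) (s := {ω | y ω ≤ t})).eq_or_lt with h1 | h1
  · rw [h1, sub_self, ENNReal.ofReal_zero] at hPB
    rw [setLIntegral_measure_zero _ _ hPB]
    exact zero_le
  · have h01 : P.real {ω | y ω ≤ t} ∈ Ico (0 : ℝ) 1 := ⟨measureReal_nonneg, h1⟩
    refine (setLIntegral_le_tail_quantileFn P hf hf0 h01.1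
      (measurableSet_lt measurable_const hy) hPB.le).trans ((hfC _ h01).trans ?_)
    rw [← hσ.setLIntegral_comp_eq hU h01.1, setLIntegral_congr (hcom t)]

lemma quantileFn_congr (P : Measure Ω) {f g : Ω → ℝ} (h : f =ᵐ[P] g) :
    quantileFn P f = quantileFn P g := by
  ext u
  unfold quantileFn
  congr 1
  ext q
  have : P {ω | f ω ≤ q} = P {ω | g ω ≤ q} := by
    refine measure_congr ?_
    filter_upwards [h] with ω hω
    exact congrArg (· ≤ q) hω
  simp [this]

lemma sigmaPow_one_eq (P : Measure Ω) (σ : ℝ → ℝ) {X : Type*} [NormedAddCommGroup X]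
    (Y : Ω → X) : sigmaPow P σ 1 Y
      = ⨆ (U : Ω → ℝ) (_ : IsUniformRV P U), ∫⁻ ω, ENNReal.ofReal (σ (U ω)) * ‖Y ω‖ₑ ∂P := by
  simp only [sigmaPow, ENNReal.rpow_one]
  rfl

lemma IsDistortion.ofReal_integral_ne_zero {σ : ℝ → ℝ} (hσ : IsDistortion σ) {α : ℝ}
    (hα : α ∈ Set.Ico (0 : ℝ) 1) : ENNReal.ofReal (∫ u in Set.Ioo α 1, σ u) ≠ 0 :=
  ne_of_gt (ENNReal.ofReal_pos.2 ((sub_pos.2 hα.2).trans_le (hσ.one_sub_le_integral hα)))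

/-- The Hölder inequality for the pair `L_σ^1`, `L*_{σ,∞}`. -/
lemma lintegral_enorm_mul_le_dualNormInf_mul_sigmaPow (P : Measure Ω) [IsProbabilityMeasure P]
    (hrich : ∃ U : Ω → ℝ, IsUniformRV P U) {σ : ℝ → ℝ} (hσ : IsDistortion σ)
    {Z Y : Ω → 𝕂} (hZ : AEStronglyMeasurable Z P) (hY : AEStronglyMeasurable Y P)
    (hfin : dualNormInf P σ Z ≠ ∞) :
    ∫⁻ ω, ‖Z ω * Y ω‖ₑ ∂P ≤ dualNormInf P σ Z * sigmaPow P σ 1 Y := by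
  have hZ' : (fun ω => ‖Z ω‖) =ᵐ[P] fun ω => ‖hZ.mk Z ω‖ := hZ.ae_eq_mk.fun_comp _
  obtain ⟨U, hU, h⟩ := exists_uniform_lintegral_mul_le P hrich hσ (f := fun ω => ‖hZ.mk Z ω‖)
    (y := fun ω => ‖hY.mk Y ω‖) hZ.stronglyMeasurable_mk.norm.measurable
    (fun _ => norm_nonneg _) hY.stronglyMeasurable_mk.norm.measurable (fun _ => norm_nonneg _)
    hfin (fun α hα => by
      rw [← ENNReal.div_le_iff (hσ.ofReal_integral_ne_zero hα) ENNReal.ofReal_ne_top,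
        ← quantileFn_congr P hZ']
      exact le_iSup₂ (f := fun (α : ℝ) (_ : α ∈ Set.Ico (0 : ℝ) 1) =>
        (∫⁻ u in Set.Ioo α 1, ENNReal.ofReal (quantileFn P (fun ω => ‖Z ω‖) u)) /
          ENNReal.ofReal (∫ u in Set.Ioo α 1, σ u)) α hα)
  simp only [ofReal_norm] at h
  calc ∫⁻ ω, ‖Z ω * Y ω‖ₑ ∂P = ∫⁻ ω, ‖hZ.mk Z ω‖ₑ * ‖hY.mk Y ω‖ₑ ∂P := by
        refine lintegral_congr_ae ?_
        filter_upwards [hZ.ae_eq_mk, hY.ae_eq_mk] with ω h1 h2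
        rw [enorm_mul, ← h1, ← h2]
    _ ≤ _ := h
    _ = dualNormInf P σ Z * ∫⁻ ω, ENNReal.ofReal (σ (U ω)) * ‖Y ω‖ₑ ∂P := by
        congr 1
        refine lintegral_congr_ae ?_
        filter_upwards [hY.ae_eq_mk] with ω h2
        rw [← h2]
    _ ≤ dualNormInf P σ Z * sigmaPow P σ 1 Y := by
        rw [sigmaPow_one_eq]
        gcongr
        exact le_iSup₂ (f := fun (U : Ω → ℝ) (_ : IsUniformRV P U) =>
          ∫⁻ ω, ENNReal.ofReal (σ (U ω)) * ‖Y ω‖ₑ ∂P) U hU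

lemma exists_setLIntegral_enorm_eq_tail (P : Measure Ω) [IsProbabilityMeasure P]
    (hrich : ∃ U : Ω → ℝ, IsUniformRV P U) {Z : Ω → 𝕂} (hZ : AEStronglyMeasurable Z P)
    {α : ℝ} (hα : α ∈ Set.Ico (0 : ℝ) 1) :
    ∃ B : Set Ω, MeasurableSet B ∧ P B = ENNReal.ofReal (1 - α) ∧ ∫⁻ ω in B, ‖Z ω‖ₑ ∂P
      = ∫⁻ u in Set.Ioo α 1, ENNReal.ofReal (quantileFn P (fun ω => ‖Z ω‖) u) := by
  have hZ' : (fun ω => ‖Z ω‖) =ᵐ[P] fun ω => ‖hZ.mk Z ω‖ := hZ.ae_eq_mk.fun_comp _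
  obtain ⟨B, hB, hPB, h⟩ := exists_setLIntegral_eq_tail_quantileFn P hrich
    (g := fun ω => ‖hZ.mk Z ω‖) hZ.stronglyMeasurable_mk.norm.measurable
    (fun _ => norm_nonneg _) hα
  refine ⟨B, hB, hPB, ?_⟩
  rw [quantileFn_congr P hZ', ← h]
  refine lintegral_congr_ae (ae_restrict_of_ae ?_)
  filter_upwards [hZ.ae_eq_mk] with ω h1
  rw [ofReal_norm, ← h1]

/-- A sum `∑ wₙ 1_{Bₙ}` dominates the `σ`-norm through the tail integrals of `σ`. -/
lemma sigmaPow_one_le_tsum (P : Measure Ω) [IsProbabilityMeasure P] {σ : ℝ → ℝ}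
    (hσ : IsDistortion σ) {ι : Type*} [Countable ι] {α : ι → ℝ}
    (hα : ∀ i, α i ∈ Set.Ico (0 : ℝ) 1) {B : ι → Set Ω} (hB : ∀ i, MeasurableSet (B i))
    (hPB : ∀ i, P (B i) = ENNReal.ofReal (1 - α i)) (w : ι → ℝ≥0∞) {Y : Ω → 𝕂}
    (hY : ∀ ω, ‖Y ω‖ₑ ≤ ∑' i, (B i).indicator (fun _ => w i) ω) :
    sigmaPow P σ 1 Y ≤ ∑' i, w i * ENNReal.ofReal (∫ u in Set.Ioo (α i) 1, σ u) := by
  rw [sigmaPow_one_eq]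
  refine iSup₂_le fun U hU => ?_
  have hm := (hσ.aemeasurable_comp hU).ennreal_ofReal
  calc ∫⁻ ω, ENNReal.ofReal (σ (U ω)) * ‖Y ω‖ₑ ∂P
      ≤ ∫⁻ ω, ∑' i, (B i).indicator (fun ω => ENNReal.ofReal (σ (U ω)) * w i) ω ∂P := by
        refine lintegral_mono fun ω => ?_
        simp only [Set.indicator_mul_right, ENNReal.tsum_mul_left]
        gcongr
        exact hY ω
    _ = ∑' i, ∫⁻ ω in B i, ENNReal.ofReal (σ (U ω)) * w i ∂P := by
        rw [lintegral_tsum fun i => (hm.mul_const _).indicator (hB i)]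
        exact tsum_congr fun i => lintegral_indicator (hB i) _
    _ ≤ _ := by
        refine ENNReal.tsum_le_tsum fun i => ?_
        rw [lintegral_mul_const'' _ hm.restrict, mul_comm]
        gcongr
        exact hσ.setLIntegral_comp_le hU (hα i) (hB i) (hPB i)

lemma KoetheDual.dualNormInf_lt_top {P : Measure Ω} [IsProbabilityMeasure P]
    (hrich : ∃ U : Ω → ℝ, IsUniformRV P U) {σ : ℝ → ℝ} (hσ : IsDistortion σ)
    {Z : Ω → 𝕂} (hZ : KoetheDual P σ 1 Z) : dualNormInf P σ Z < ∞ := by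
  by_contra htop
  have hlarge : ∀ n : ℕ, ∃ α ∈ Set.Ico (0 : ℝ) 1, (4 : ℝ≥0∞) ^ n <
      (∫⁻ u in Set.Ioo α 1, ENNReal.ofReal (quantileFn P (fun ω => ‖Z ω‖) u)) /
      ENNReal.ofReal (∫ u in Set.Ioo α 1, σ u) := by
    intro n
    have h : (4 : ℝ≥0∞) ^ n < dualNormInf P σ Z := by
      rw [not_lt_top_iff.1 htop]
      exact ENNReal.pow_lt_top (by simp)
    obtain ⟨α, h⟩ := lt_iSup_iff.1 h
    obtain ⟨hα, h⟩ := lt_iSup_iff.1 h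
    exact ⟨α, hα, h⟩
  choose α hα hαZ using hlarge
  choose B hB hPB hBZ using fun n => exists_setLIntegral_enorm_eq_tail P hrich hZ.1 (hα n)
  let S : ℕ → ℝ≥0∞ := fun n => ENNReal.ofReal (∫ u in Set.Ioo (α n) 1, σ u)
  have hS0 : ∀ n, S n ≠ 0 := fun n => hσ.ofReal_integral_ne_zero (hα n)
  have hS : ∀ n, S n ≠ ∞ := fun n => ENNReal.ofReal_ne_top
  let w : ℕ → ℝ≥0∞ := fun n => 2⁻¹ ^ n / S n
  have hwS : ∀ n, w n * S n = 2⁻¹ ^ n := fun n => ENNReal.div_mul_cancel (hS0 n) (hS n)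
  have hgeom : ∑' n : ℕ, (2⁻¹ : ℝ≥0∞) ^ n ≠ ∞ := by
    rw [ENNReal.tsum_geometric, ENNReal.one_sub_inv_two, inv_inv]
    simp
  let Y₀ : Ω → ℝ≥0∞ := fun ω => ∑' n, (B n).indicator (fun _ => w n) ω
  have hY₀m : Measurable Y₀ := Measurable.tsum fun n => measurable_const.indicator (hB n)
  have hY₀ : ∀ᵐ ω ∂P, Y₀ ω < ∞ := by
    refine ae_lt_top' hY₀m.aemeasurable (ne_top_of_le_ne_top hgeom ?_)
    rw [lintegral_tsum fun n => (measurable_const.indicator (hB n)).aemeasurable]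
    refine ENNReal.tsum_le_tsum fun n => ?_
    rw [lintegral_indicator (hB n), setLIntegral_const, hPB n, ← hwS n]
    gcongr
    exact ENNReal.ofReal_le_ofReal (hσ.one_sub_le_integral (hα n))
  let Y : Ω → 𝕂 := fun ω => ((Y₀ ω).toReal : 𝕂)
  have hYe : ∀ ω, ‖Y ω‖ₑ = ENNReal.ofReal (Y₀ ω).toReal := fun ω => by
    rw [← ofReal_norm, RCLike.norm_ofReal, abs_of_nonneg ENNReal.toReal_nonneg]
  have hYmem : MemLsigma P σ 1 Y := by
    refine ⟨(RCLike.measurable_ofReal.comp hY₀m.ennreal_toReal).aestronglyMeasurable, ?_⟩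
    refine lt_of_le_of_lt (sigmaPow_one_le_tsum P hσ hα hB hPB w fun ω => ?_)
      (lt_top_iff_ne_top.2 ?_)
    · rw [hYe]
      exact ENNReal.ofReal_toReal_le
    · rwa [tsum_congr hwS]
  have hI := (hZ.2 Y hYmem).hasFiniteIntegral
  rw [hasFiniteIntegral_iff_enorm] at hI
  have hbound : ∀ n : ℕ, (n : ℝ≥0∞) ≤ ∫⁻ ω, ‖Z ω * Y ω‖ₑ ∂P := by
    intro n
    calc (n : ℝ≥0∞) ≤ 2 ^ n := by exact_mod_cast n.lt_two_pow_self.le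
      _ = 2⁻¹ ^ n * 4 ^ n := by
        rw [← mul_pow, show (4 : ℝ≥0∞) = 2 * 2 by norm_num, ← mul_assoc,
          ENNReal.inv_mul_cancel (by simp) (by simp), one_mul]
      _ ≤ 2⁻¹ ^ n * ((∫⁻ ω in B n, ‖Z ω‖ₑ ∂P) / S n) := by
        rw [hBZ n]
        gcongr
        exact (hαZ n).le
      _ = ∫⁻ ω in B n, ‖Z ω‖ₑ * w n ∂P := by
        rw [lintegral_mul_const'' _ hZ.1.enorm.restrict]
        simp only [w, div_eq_mul_inv]
        ring
      _ = ∫⁻ ω, (B n).indicator (fun ω => ‖Z ω‖ₑ * w n) ω ∂P :=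
        (lintegral_indicator (hB n) _).symm
      _ ≤ ∫⁻ ω, ‖Z ω * Y ω‖ₑ ∂P := by
        refine lintegral_mono_ae ?_
        filter_upwards [hY₀] with ω hω
        rw [enorm_mul, hYe, ENNReal.ofReal_toReal hω.ne, Set.indicator_mul_right]
        gcongr
        exact ENNReal.le_tsum (f := fun n => (B n).indicator (fun _ => w n) ω) n
  obtain ⟨n, hn⟩ := ENNReal.exists_nat_gt hI.ne
  exact absurd (hbound n) (not_le.2 hn)

lemma koetheDual_of_dualNormInf_lt_top {P : Measure Ω} [IsProbabilityMeasure P]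
    (hrich : ∃ U : Ω → ℝ, IsUniformRV P U) {σ : ℝ → ℝ} (hσ : IsDistortion σ)
    {Z : Ω → 𝕂} (hZ : AEStronglyMeasurable Z P) (hfin : dualNormInf P σ Z < ∞) :
    KoetheDual P σ 1 Z := by
  refine ⟨hZ, fun Y hY => ⟨hZ.mul hY.1, ?_⟩⟩
  rw [hasFiniteIntegral_iff_enorm]
  exact (lintegral_enorm_mul_le_dualNormInf_mul_sigmaPow P hrich hσ hZ hY.1 hfin.ne).trans_lt
    (ENNReal.mul_lt_top hfin hY.2)

lemma KoetheDual.exists_memLsigma_tail_div_le {P : Measure Ω} [IsProbabilityMeasure P]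
    (hrich : ∃ U : Ω → ℝ, IsUniformRV P U) {σ : ℝ → ℝ} (hσ : IsDistortion σ)
    {Z : Ω → 𝕂} (hZ : KoetheDual P σ 1 Z) {α : ℝ} (hα : α ∈ Set.Ico (0 : ℝ) 1) :
    ∃ Y : Ω → 𝕂, MemLsigma P σ 1 Y ∧ sigmaPow P σ 1 Y ≤ 1 ∧
      (∫⁻ u in Set.Ioo α 1, ENNReal.ofReal (quantileFn P (fun ω => ‖Z ω‖) u)) /
        ENNReal.ofReal (∫ u in Set.Ioo α 1, σ u) ≤ ENNReal.ofReal ‖∫ ω, Z ω * Y ω ∂P‖ := by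
  obtain ⟨B, hB, hPB, hBZ⟩ := exists_setLIntegral_enorm_eq_tail P hrich hZ.1 hα
  set s : ℝ := ∫ u in Set.Ioo α 1, σ u with hs
  have hs0 : 0 < s := (sub_pos.2 hα.2).trans_le (hσ.one_sub_le_integral hα)
  set Z' := hZ.1.mk Z with hZ'
  have hZ'm : Measurable Z' := hZ.1.stronglyMeasurable_mk.measurable
  let c : Ω → 𝕂 := fun ω => (starRingEnd 𝕂) (Z' ω) / (‖Z' ω‖ : 𝕂) * ((s⁻¹ : ℝ) : 𝕂)
  let Y : Ω → 𝕂 := B.indicator c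
  have hcm : Measurable c :=
    (((RCLike.continuous_conj.measurable.comp hZ'm).div
      (RCLike.measurable_ofReal.comp hZ'm.norm)).mul_const _)
  have hcn : ∀ ω, ‖c ω‖ ≤ s⁻¹ := fun ω => by
    simp only [c, norm_mul, norm_div, RCLike.norm_conj, RCLike.norm_ofReal, abs_norm,
      abs_of_pos (inv_pos.2 hs0)]
    exact mul_le_of_le_one_left (inv_pos.2 hs0).le (div_self_le_one _)
  have hYs : sigmaPow P σ 1 Y ≤ 1 := by
    refine (sigmaPow_one_le_tsum P hσ (ι := Unit) (fun _ => hα) (fun _ => hB) (fun _ => hPB)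
      (fun _ => ENNReal.ofReal s⁻¹) fun ω => ?_).trans ?_
    · rw [tsum_fintype, Fintype.sum_unique, enorm_indicator_eq_indicator_enorm]
      refine Set.indicator_le_indicator ?_
      rw [← ofReal_norm]
      exact ENNReal.ofReal_le_ofReal (hcn ω)
    · rw [tsum_fintype, Fintype.sum_unique, ← hs, ← ENNReal.ofReal_mul (inv_pos.2 hs0).le,
        inv_mul_cancel₀ hs0.ne', ENNReal.ofReal_one]
  have hYmem : MemLsigma P σ 1 Y :=
    ⟨(hcm.indicator hB).aestronglyMeasurable, hYs.trans_lt ENNReal.one_lt_top⟩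
  refine ⟨Y, hYmem, hYs, ?_⟩
  have hint := hZ.2 Y hYmem
  have hZY : ∀ᵐ ω ∂P, Z ω * Y ω = ((B.indicator (fun ω => ‖Z ω‖ * s⁻¹) ω : ℝ) : 𝕂) := by
    filter_upwards [hZ.1.ae_eq_mk] with ω hω
    by_cases hωB : ω ∈ B
    · simp only [Y, c, Set.indicator_of_mem hωB, hω, ← hZ']
      rcases eq_or_ne (Z' ω) 0 with h0 | h0
      · simp [h0]
      · have hn : (‖Z' ω‖ : 𝕂) ≠ 0 := by simpa using h0
        rw [← mul_assoc, mul_div_assoc', RCLike.mul_conj, RCLike.ofReal_mul, sq,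
          mul_div_cancel_right₀ _ hn]
    · simp [Y, Set.indicator_of_notMem hωB]
  have hnn : ∀ ω, 0 ≤ B.indicator (fun ω => ‖Z ω‖ * s⁻¹) ω := fun ω =>
    Set.indicator_nonneg (fun _ _ => mul_nonneg (norm_nonneg _) (inv_pos.2 hs0).le) ω
  have hint' : Integrable (B.indicator fun ω => ‖Z ω‖ * s⁻¹) P := by
    refine hint.norm.congr ?_
    filter_upwards [hZY] with ω hω
    rw [hω, RCLike.norm_ofReal, abs_of_nonneg (hnn ω)]
  rw [integral_congr_ae hZY, integral_ofReal, RCLike.norm_ofReal,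
    abs_of_nonneg (integral_nonneg hnn),
    ofReal_integral_eq_lintegral_ofReal hint' (.of_forall hnn), ← hBZ]
  refine le_of_eq ?_
  calc (∫⁻ ω in B, ‖Z ω‖ₑ ∂P) / ENNReal.ofReal s
      = ∫⁻ ω in B, ‖Z ω‖ₑ * ENNReal.ofReal s⁻¹ ∂P := by
        rw [lintegral_mul_const'' _ hZ.1.enorm.restrict, ENNReal.ofReal_inv_of_pos hs0,
          div_eq_mul_inv]
    _ = ∫⁻ ω, ENNReal.ofReal (B.indicator (fun ω => ‖Z ω‖ * s⁻¹) ω) ∂P := by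
        rw [← lintegral_indicator hB]
        refine lintegral_congr fun ω => ?_
        by_cases hωB : ω ∈ B
        · simp only [Set.indicator_of_mem hωB]
          rw [ENNReal.ofReal_mul (norm_nonneg _), ofReal_norm]
        · simp [Set.indicator_of_notMem hωB]

/-- `L_σ^1(P)^× = L*_{σ,∞}(P)`, and for `Z ∈ L_σ^1(P)^×`:
`|Z|*_{σ,∞} = sup{|E(ZY)| : Y ∈ L_σ^1(P), ‖Y‖_{σ,1} ≤ 1}`. -/
theorem statement13
    (P : Measure Ω) [IsProbabilityMeasure P]
    (hrich : ∃ U : Ω → ℝ, IsUniformRV P U)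
    {𝕂 : Type*} [RCLike 𝕂]
    (σ : ℝ → ℝ) (hσ : IsDistortion σ) :
    (∀ Z : Ω → 𝕂, AEStronglyMeasurable Z P →
      (KoetheDual P σ 1 Z ↔ dualNormInf P σ Z < ∞)) ∧
    (∀ Z : Ω → 𝕂, KoetheDual P σ 1 Z →
      dualNormInf P σ Z
        = ⨆ (Y : Ω → 𝕂) (_ : MemLsigma P σ 1 Y ∧ sigmaNorm P σ 1 Y ≤ 1),
            ENNReal.ofReal ‖∫ ω, Z ω * Y ω ∂P‖) := by
  refine ⟨fun Z hZ => ⟨fun h => h.dualNormInf_lt_top hrich hσ,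
    koetheDual_of_dualNormInf_lt_top hrich hσ hZ⟩, fun Z hZ => le_antisymm ?_ ?_⟩
  · refine iSup₂_le fun α hα => ?_
    obtain ⟨Y, hY, hY1, h⟩ := hZ.exists_memLsigma_tail_div_le hrich hσ hα
    refine h.trans (le_iSup₂_of_le Y ⟨hY, ?_⟩ le_rfl)
    simpa [sigmaNorm] using hY1
  · refine iSup₂_le fun Y hY => ?_
    have hY1 : sigmaPow P σ 1 Y ≤ 1 := by simpa [sigmaNorm] using hY.2
    calc ENNReal.ofReal ‖∫ ω, Z ω * Y ω ∂P‖ ≤ ∫⁻ ω, ‖Z ω * Y ω‖ₑ ∂P := by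
          rw [ofReal_norm]
          exact enorm_integral_le_lintegral_enorm _
      _ ≤ dualNormInf P σ Z * sigmaPow P σ 1 Y :=
          lintegral_enorm_mul_le_dualNormInf_mul_sigmaPow P hrich hσ hZ.1 hY.1.1
            (hZ.dualNormInf_lt_top hrich hσ).ne
      _ ≤ dualNormInf P σ Z := mul_le_of_le_one_right' hY1

end
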